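/- Let $t_1, \ldots, t_n$ be distinct real numbers and let $\varepsilon > 0$ be such that $|t_j - t_k| > \varepsilon$ for all $j \ne k$. Let $\Delta(t) = \max\{0, 1 - |t|/\varepsilon\}$ be the triangle function. Then for any $f : \{t_1,\ldots,t_n\} \to \mathbb{C}$ with $|f(t_j)| \le 1$ for all $j$, the function $F(t) = \sum_{j=1}^n f(t_j) \Delta(t - t_j)$ satisfies $\|\widehat{F}\|_{L^1(\mathbb{R})} \le \sqrt{n}$, where $\widehat{F}(x) = \frac{1}{2\pi}\int_{\mathbb{R}} F(t) e^{-ixt}\,dt$; moreover $F(t_k) = f(t_k)$ for each $k$. -/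

import Mathlib

open MeasureTheory Complex

noncomputable def tri (ε s : ℝ) : ℝ := max 0 (1 - |s| / ε)

noncomputable def fejL (ε x : ℝ) : ℝ := 2 * (1 - Real.cos (ε * x)) / (ε * x ^ 2)

lemma tri_cont (ε : ℝ) : Continuous (tri ε) := by
  unfold tri; fun_prop

lemma tri_zero_of {ε s : ℝ} (hε : 0 < ε) (h : ε ≤ |s|) : tri ε s = 0 := by
  unfold tri
  have : 1 ≤ |s| / ε := by rwa [le_div_iff₀ hε, one_mul]
  exact max_eq_left (by linarith)

lemma tri_eq_of {ε s : ℝ} (hε : 0 < ε) (h : |s| ≤ ε) : tri ε s = 1 - |s| / ε := by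
  unfold tri
  have : |s| / ε ≤ 1 := by rwa [div_le_iff₀ hε, one_mul]
  exact max_eq_right (by linarith)

lemma tri_supp {ε : ℝ} (hε : 0 < ε) : HasCompactSupport (tri ε) := by
  apply HasCompactSupport.intro (isCompact_Icc (a := -ε) (b := ε))
  intro x hx
  apply tri_zero_of hε
  by_contra! h
  exact hx (abs_le.mp h.le)

lemma tri_int_exp {ε : ℝ} (hε : 0 < ε) (u : ℝ) (g : ℝ → ℂ) (hg : Continuous g) :
    Integrable (fun s : ℝ => (tri ε (s - u) : ℂ) * g s) := by
  apply Continuous.integrable_of_hasCompactSupport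
  · have := tri_cont ε
    fun_prop
  · apply HasCompactSupport.mul_right
    apply HasCompactSupport.intro (isCompact_Icc (a := u - ε) (b := u + ε))
    intro x hx
    rw [tri_zero_of hε, ofReal_zero]
    by_contra! h
    have := abs_le.mp h.le
    exact hx ⟨by linarith, by linarith⟩

lemma half_int {ε : ℝ} (hε : 0 < ε) (a : ℂ) (ha : a ≠ 0) :
    ∫ s in (0:ℝ)..ε, (tri ε s : ℂ) * exp (a * s)
      = exp (a * ε) / (ε * a ^ 2) - 1 / a - 1 / (ε * a ^ 2) := by
  have hε' : (ε : ℂ) ≠ 0 := by exact_mod_cast hε.ne'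
  have h1 : ∫ s in (0:ℝ)..ε, (tri ε s : ℂ) * exp (a * s)
      = ∫ s in (0:ℝ)..ε, (1 - (s : ℂ) / ε) * exp (a * s) := by
    apply intervalIntegral.integral_congr
    intro s hs
    rw [Set.uIcc_of_le hε.le] at hs
    simp only
    rw [tri_eq_of hε (by rw [abs_of_nonneg hs.1]; exact hs.2), abs_of_nonneg hs.1]
    push_cast; rfl
  rw [h1, intervalIntegral.integral_eq_sub_of_hasDerivAt
    (f := fun s : ℝ => (1 - (s : ℂ) / ε) * exp (a * s) / a + exp (a * s) / (ε * a ^ 2))]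
  · simp [hε']
    ring
  · intro s _
    have hs : HasDerivAt (fun s : ℝ => (s : ℂ)) 1 s := ofRealCLM.hasDerivAt
    have he : HasDerivAt (fun s : ℝ => exp (a * s)) (exp (a * s) * (a * 1)) s :=
      (hs.const_mul a).cexp
    have hl : HasDerivAt (fun s : ℝ => 1 - (s : ℂ) / ε) (-(1 / ε)) s :=
      (hs.div_const (ε : ℂ)).const_sub 1
    have := ((hl.mul he).div_const a).add (he.div_const (ε * a ^ 2))
    refine HasDerivAt.congr_deriv (f := fun s : ℝ => (1 - (s : ℂ) / ε) * exp (a * s) / a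
      + exp (a * s) / (ε * a ^ 2)) this ?_
    field_simp
    ring
  · apply Continuous.intervalIntegrable
    fun_prop

lemma tri_neg (ε s : ℝ) : tri ε (-s) = tri ε s := by simp [tri]

lemma four_tri {ε : ℝ} (hε : 0 < ε) (x : ℝ) (hx : x ≠ 0) :
    ∫ s : ℝ, (tri ε s : ℂ) * exp (-(I * x * s)) = (fejL ε x : ℂ) := by
  have hε' : (ε : ℂ) ≠ 0 := by exact_mod_cast hε.ne'
  have hx' : (x : ℂ) ≠ 0 := by exact_mod_cast hx
  have hc : Continuous (fun s : ℝ => (tri ε s : ℂ) * exp (-(I * x * s))) := by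
    have := tri_cont ε
    fun_prop
  have h1 : ∫ s : ℝ, (tri ε s : ℂ) * exp (-(I * x * s))
      = ∫ s in (-ε)..ε, (tri ε s : ℂ) * exp (-(I * x * s)) := by
    symm
    apply intervalIntegral.integral_eq_integral_of_support_subset
    intro s hs
    by_contra hns
    apply hs
    simp only
    rw [tri_zero_of hε, ofReal_zero, zero_mul]
    by_contra! h
    have := abs_lt.mp h
    exact hns ⟨this.1, this.2.le⟩
  rw [h1, ← intervalIntegral.integral_add_adjacent_intervals (b := 0)
    (hc.intervalIntegrable _ _) (hc.intervalIntegrable _ _)]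
  have h2 : ∫ s in (-ε)..0, (tri ε s : ℂ) * exp (-(I * x * s))
      = ∫ s in (0:ℝ)..ε, (tri ε s : ℂ) * exp ((I * x) * s) := by
    have := intervalIntegral.integral_comp_neg (a := 0) (b := ε)
      (fun s : ℝ => (tri ε s : ℂ) * exp (-(I * x * s)))
    rw [neg_zero] at this
    rw [← this]
    congr 1
    ext s
    rw [tri_neg]
    push_cast
    congr 2
    ring
  have h3 : ∫ s in (0:ℝ)..ε, (tri ε s : ℂ) * exp (-(I * x * s))
      = ∫ s in (0:ℝ)..ε, (tri ε s : ℂ) * exp ((-(I * x)) * s) := by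
    simp only [neg_mul]
  rw [h2, h3, half_int hε _ (mul_ne_zero I_ne_zero hx'),
    half_int hε _ (neg_ne_zero.mpr (mul_ne_zero I_ne_zero hx'))]
  unfold fejL
  push_cast
  rw [Complex.cos]
  have e1 : (ε : ℂ) * x * I = I * x * ε := by ring
  have e2 : -((ε : ℂ) * x) * I = -(I * x) * ε := by ring
  rw [e1, e2, neg_sq, mul_pow, I_sq]
  field_simp
  ring

lemma fejL_nonneg {ε : ℝ} (hε : 0 < ε) (x : ℝ) : 0 ≤ fejL ε x := by
  unfold fejL
  have := Real.cos_le_one (ε * x)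
  have : 0 ≤ 1 - Real.cos (ε * x) := by linarith
  positivity

lemma fejL_meas (ε : ℝ) : Measurable (fejL ε) := by
  unfold fejL; fun_prop

lemma fejL_integrable {ε : ℝ} (hε : 0 < ε) : Integrable (fejL ε) := by
  apply (integrable_inv_one_add_sq.const_mul (ε + 4 / ε)).mono' (fejL_meas ε).aestronglyMeasurable
  filter_upwards with x
  rw [Real.norm_of_nonneg (fejL_nonneg hε x), ← div_eq_mul_inv, le_div_iff₀ (by positivity)]
  by_cases hx : x = 0
  · subst hx
    simp [fejL]
    positivity
  have h1 : fejL ε x ≤ ε := by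
    unfold fejL
    have := Real.one_sub_sq_div_two_le_cos (x := ε * x)
    rw [div_le_iff₀ (by positivity)]
    nlinarith
  have h2 : fejL ε x * x ^ 2 ≤ 4 / ε := by
    unfold fejL
    have := Real.neg_one_le_cos (ε * x)
    have e : 2 * (1 - Real.cos (ε * x)) / (ε * x ^ 2) * x ^ 2 = 2 * (1 - Real.cos (ε * x)) / ε := by
      field_simp
    rw [e]
    gcongr
    linarith
  linarith

lemma ae_ne_zero' : ∀ᵐ x : ℝ, x ≠ 0 := by
  simp [ae_iff]

open FourierTransform in
lemma fejL_inv {ε : ℝ} (hε : 0 < ε) (v : ℝ) :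
    ∫ x : ℝ, (fejL ε x : ℂ) * exp (I * x * v) = 2 * Real.pi * (tri ε v : ℂ) := by
  have hpi : (2 * Real.pi) ≠ 0 := by positivity
  have hF : 𝓕 (fun s : ℝ => (tri ε s : ℂ)) =ᵐ[volume]
      fun ξ : ℝ => (fejL ε (2 * Real.pi * ξ) : ℂ) := by
    filter_upwards [ae_ne_zero'] with ξ hξ
    rw [← four_tri hε _ (mul_ne_zero hpi hξ), Real.fourier_eq']
    congr 1
    ext s
    simp only [smul_eq_mul, RCLike.inner_apply, conj_trivial]
    rw [mul_comm]
    congr 2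
    push_cast
    ring
  have hLi : Integrable (fun ξ : ℝ => (fejL ε (2 * Real.pi * ξ) : ℂ)) :=
    ((fejL_integrable hε).comp_mul_left' hpi).ofReal
  have hti : Integrable (fun s : ℝ => (tri ε s : ℂ)) := by
    simpa using tri_int_exp hε 0 (fun _ => 1) continuous_const
  have hcont : Continuous (fun s : ℝ => (tri ε s : ℂ)) := by
    have := tri_cont ε
    fun_prop
  have hinv := congrFun (hcont.fourierInv_fourier_eq hti (hLi.congr hF.symm)) v
  rw [Real.fourierInv_eq'] at hinv
  rw [← hinv]
  have : ∫ ξ : ℝ, exp ((↑(2 * Real.pi * inner ℝ ξ v) * I)) • 𝓕 (fun s : ℝ => (tri ε s : ℂ)) ξ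
      = ∫ ξ : ℝ, (fun x : ℝ => (fejL ε x : ℂ) * exp (I * x * v)) (2 * Real.pi * ξ) := by
    apply integral_congr_ae
    filter_upwards [hF] with ξ hξ
    rw [hξ]
    simp only [smul_eq_mul, RCLike.inner_apply, conj_trivial]
    rw [mul_comm]
    congr 2
    push_cast
    ring
  rw [this, Measure.integral_comp_mul_left (fun x : ℝ => (fejL ε x : ℂ) * exp (I * x * v)), abs_of_pos (by positivity), real_smul]
  push_cast
  have : (Real.pi : ℂ) ≠ 0 := by exact_mod_cast Real.pi_ne_zero
  rw [← mul_assoc, mul_inv_cancel₀ (mul_ne_zero two_ne_zero this), one_mul]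

lemma four_tri_shift {ε : ℝ} (hε : 0 < ε) (u x : ℝ) (hx : x ≠ 0) :
    ∫ s : ℝ, (tri ε (s - u) : ℂ) * exp (-(I * x * s)) = exp (-(I * x * u)) * (fejL ε x : ℂ) := by
  rw [← four_tri hε x hx, ← integral_const_mul,
    ← integral_sub_right_eq_self (fun s : ℝ => exp (-(I * x * u)) *
      ((tri ε s : ℂ) * exp (-(I * x * s)))) u]
  congr 1
  ext s
  rw [mul_left_comm, ← exp_add]
  congr 2
  push_cast
  ring

theorem stmt12 (n : ℕ) (t : Fin n → ℝ) (ht : Function.Injective t)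
    (ε : ℝ) (hε : 0 < ε) (hsep : ∀ j k, j ≠ k → ε < |t j - t k|)
    (f : Fin n → ℂ) (hf : ∀ j, ‖f j‖ ≤ 1)
    (F : ℝ → ℂ) (hF : ∀ s, F s = ∑ j, f j * ((max 0 (1 - |s - t j| / ε) : ℝ) : ℂ)) :
    (∫ x : ℝ, ‖(1 / (2 * Real.pi) : ℂ) *
        ∫ s : ℝ, F s * Complex.exp (-(Complex.I * x * s))‖) ≤ Real.sqrt n ∧
      ∀ k, F (t k) = f k := by
  have hF' : ∀ s, F s = ∑ j, f j * (tri ε (s - t j) : ℂ) := hF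
  have htri : ∀ j k, tri ε (t j - t k) = if j = k then 1 else 0 := by
    intro j k
    split_ifs with h
    · subst h; simp [tri]
    · exact tri_zero_of hε (hsep j k h).le
  refine ⟨?_, fun k => by simp [hF', htri, apply_ite (fun r : ℝ => (r : ℂ))]⟩
  rcases Nat.eq_zero_or_pos n with hn | hn
  · subst hn
    simp [hF']
  have hn' : (0:ℝ) < n := by exact_mod_cast hn
  have hsq : 0 < Real.sqrt n := Real.sqrt_pos.mpr hn'
  have hss : Real.sqrt n * Real.sqrt n = n := Real.mul_self_sqrt hn'.le
  set P : ℝ → ℂ := fun x => ∑ j, f j * exp (-(I * x * t j)) with hP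
  have hPc : Continuous P := by fun_prop
  -- Fourier transform
  have hA : ∀ x : ℝ, x ≠ 0 →
      ∫ s : ℝ, F s * exp (-(I * x * s)) = P x * (fejL ε x : ℂ) := by
    intro x hx
    have : ∀ s : ℝ, F s * exp (-(I * x * s))
        = ∑ j, f j * ((tri ε (s - t j) : ℂ) * exp (-(I * x * s))) := by
      intro s
      rw [hF', Finset.sum_mul]
      simp only [mul_assoc]
    simp only [this]
    rw [integral_finsetSum]
    · simp only [integral_const_mul, four_tri_shift hε _ x hx, hP, Finset.sum_mul]
      simp only [mul_assoc]
    · intro j _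
      exact (tri_int_exp hε _ _ (by fun_prop)).const_mul _
  have hLi := fejL_integrable hε
  -- second moment
  have hterm : ∀ j k, Integrable (fun x : ℝ => (f j * (starRingEnd ℂ) (f k)) *
      ((fejL ε x : ℂ) * exp (I * x * ((t k - t j : ℝ) : ℂ)))) := by
    intro j k
    apply Integrable.const_mul
    apply hLi.ofReal.mul_bdd (c := 1)
    · apply Continuous.aestronglyMeasurable; fun_prop
    · filter_upwards with x
      have : I * x * ((t k - t j : ℝ) : ℂ) = ((x * (t k - t j) : ℝ) : ℂ) * I := by
        push_cast; ring
      rw [this, norm_exp_ofReal_mul_I]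
  have hexpand : ∀ x : ℝ, ((‖P x‖ ^ 2 * fejL ε x : ℝ) : ℂ) = ∑ j, ∑ k,
      (f j * (starRingEnd ℂ) (f k)) *
      ((fejL ε x : ℂ) * exp (I * x * ((t k - t j : ℝ) : ℂ))) := by
    intro x
    push_cast
    rw [← mul_conj', hP]
    simp only [map_sum, map_mul, ← exp_conj, map_neg, conj_I, conj_ofReal]
    rw [Finset.sum_mul_sum, Finset.sum_mul]
    refine Finset.sum_congr rfl fun j _ => ?_
    rw [Finset.sum_mul]
    refine Finset.sum_congr rfl fun k _ => ?_
    have : I * x * ((t k : ℂ) - t j) = -(I * x * t j) + -(-I * x * t k) := by ring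
    rw [this, exp_add]
    ring
  have hP2i : Integrable (fun x => ‖P x‖ ^ 2 * fejL ε x) := by
    have : Integrable (fun x => ((‖P x‖ ^ 2 * fejL ε x : ℝ) : ℂ)) := by
      simp only [hexpand]
      exact integrable_finsetSum _ fun j _ => integrable_finsetSum _ fun k _ => hterm j k
    have h2 := this.re
    simp only [RCLike.re_eq_complex_re, ofReal_re] at h2
    exact h2
  have hP2 : ∫ x, ‖P x‖ ^ 2 * fejL ε x = 2 * Real.pi * ∑ j, ‖f j‖ ^ 2 := by
    have : ((∫ x, ‖P x‖ ^ 2 * fejL ε x : ℝ) : ℂ) = ((2 * Real.pi * ∑ j, ‖f j‖ ^ 2 : ℝ) : ℂ) := by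
      rw [← integral_complex_ofReal]
      simp only [hexpand]
      rw [integral_finsetSum _ fun j _ => integrable_finsetSum _ fun k _ => hterm j k]
      rw [ofReal_mul, ofReal_sum, Finset.mul_sum]
      refine Finset.sum_congr rfl fun j _ => ?_
      rw [integral_finsetSum _ fun k _ => hterm j k]
      simp only [integral_const_mul]
      simp only [fejL_inv hε, htri]
      rw [Finset.sum_eq_single j]
      · simp only [if_true, ofReal_one, mul_one]
        rw [mul_conj']; push_cast; ring
      · intro k _ hk
        simp [hk]
      · simp
    exact_mod_cast this
  have hL1 : ∫ x, fejL ε x = 2 * Real.pi := by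
    have h := fejL_inv hε 0
    have h0 : tri ε 0 = 1 := by simp [tri]
    rw [h0] at h
    simp only [ofReal_zero, mul_zero, exp_zero, mul_one, ofReal_one] at h
    rw [integral_complex_ofReal] at h
    exact_mod_cast h
  have hsum : ∑ j, ‖f j‖ ^ 2 ≤ (n : ℝ) := by
    calc ∑ j, ‖f j‖ ^ 2 ≤ ∑ j : Fin n, (1:ℝ) :=
          Finset.sum_le_sum fun j _ => pow_le_one₀ (norm_nonneg _) (hf j)
      _ = n := by simp
  have hpi := Real.pi_pos
  calc (∫ x : ℝ, ‖(1 / (2 * Real.pi) : ℂ) * ∫ s : ℝ, F s * exp (-(I * x * s))‖)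
      ≤ ∫ x, (1 / (2 * Real.pi)) * ((1 / (2 * Real.sqrt n)) * (‖P x‖ ^ 2 * fejL ε x)
          + (Real.sqrt n / 2) * fejL ε x) := by
        apply integral_mono_of_nonneg
        · filter_upwards with x using norm_nonneg _
        · exact ((hP2i.const_mul _).add (hLi.const_mul _)).const_mul _
        · filter_upwards [ae_ne_zero'] with x hx
          rw [hA x hx]
          have e : ‖(1 / (2 * Real.pi) : ℂ)‖ = 1 / (2 * Real.pi) := by
            have : (1 / (2 * Real.pi) : ℂ) = ((1 / (2 * Real.pi) : ℝ) : ℂ) := by push_cast; rfl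
            rw [this, norm_real, Real.norm_of_nonneg (by positivity)]
          rw [norm_mul, e, norm_mul, norm_real, Real.norm_of_nonneg (fejL_nonneg hε x)]
          apply mul_le_mul_of_nonneg_left _ (by positivity)
          rw [← mul_assoc, ← add_mul]
          apply mul_le_mul_of_nonneg_right _ (fejL_nonneg hε x)
          rw [← sub_nonneg]
          have : 1 / (2 * Real.sqrt n) * ‖P x‖ ^ 2 + Real.sqrt n / 2 - ‖P x‖
              = (‖P x‖ - Real.sqrt n) ^ 2 / (2 * Real.sqrt n) := by
            field_simp
            ring
          rw [this]
          positivity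
    _ = (1 / (2 * Real.sqrt n)) * (∑ j, ‖f j‖ ^ 2) + Real.sqrt n / 2 := by
        rw [integral_const_mul, integral_add (hP2i.const_mul _) (hLi.const_mul _),
          integral_const_mul, integral_const_mul, hP2, hL1]
        field_simp
    _ ≤ (1 / (2 * Real.sqrt n)) * n + Real.sqrt n / 2 := by gcongr
    _ = Real.sqrt n := by
        nth_rewrite 2 [← hss]
        field_simp
        ring
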